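/- arXiv:1102.4211 — 6 statements merged into one kernel-verified Lean document; each statement's English description precedes it below -/
import Mathlib

section
/- Let n ≥ 2, let r be an integer with 1 ≤ r ≤ n−1, and let a, b ≥ 0 be integers. Define, as rational numbers, x(a,b,r) = (r/(a+r))·C(n−1,r)·C(a+n−1,a)·C(b+n−2,b), y(a,b,r) = (r/(b+n−r))·C(n−1,r)·C(a+n−2,a)·C(b+n−1,b), and m(a,b,r) = (r(a+b+n)/((a+r)(b+n−r)))·C(n−1,r)·C(a+n−1,a)·C(b+n−1,b), where C(p,q) denotes the binomial coefficient. Then Σ_{j=0}^{b} x(a,j,r) + Σ_{i=0}^{a} y(i,b,r) = m(a,b,r). -/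
/-- The parallel summation (hockey-stick) identity for binomial coefficients. -/
theorem sum_range_choose_add_self (m b : ℕ) :
    ∑ j ∈ Finset.range (b + 1), (j + m).choose j = (b + m + 1).choose b := by
  induction b with
  | zero => simp
  | succ b ih =>
    rw [Finset.sum_range_succ, ih, show b + 1 + m = b + m + 1 by omega,
      ← Nat.choose_succ_succ']

/-- Dimension count for the Cauchy–Kovalevskaya decomposition:
`x(a,b,r) = (r/(a+r))·C(n−1,r)·C(a+n−1,a)·C(b+n−2,b)`,
`y(a,b,r) = (r/(b+n−r))·C(n−1,r)·C(a+n−2,a)·C(b+n−1,b)`,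
`m(a,b,r) = (r(a+b+n)/((a+r)(b+n−r)))·C(n−1,r)·C(a+n−1,a)·C(b+n−1,b)`,
and `Σ_{j=0}^{b} x(a,j,r) + Σ_{i=0}^{a} y(i,b,r) = m(a,b,r)` in `ℚ`. -/
theorem dimension_sum_CK (n r a b : ℕ) (hn : 2 ≤ n) (hr1 : 1 ≤ r) (hr2 : r ≤ n - 1) :
    (∑ j ∈ Finset.range (b + 1),
        (r : ℚ) / ((a : ℚ) + r) * ((n - 1).choose r : ℚ) * ((a + n - 1).choose a : ℚ) *
          ((j + n - 2).choose j : ℚ))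
      + (∑ i ∈ Finset.range (a + 1),
        (r : ℚ) / ((b : ℚ) + n - r) * ((n - 1).choose r : ℚ) * ((i + n - 2).choose i : ℚ) *
          ((b + n - 1).choose b : ℚ))
    = ((r : ℚ) * ((a : ℚ) + b + n)) / (((a : ℚ) + r) * ((b : ℚ) + n - r)) *
        ((n - 1).choose r : ℚ) * ((a + n - 1).choose a : ℚ) * ((b + n - 1).choose b : ℚ) := by
  obtain ⟨m, rfl⟩ : ∃ m, n = m + 2 := ⟨n - 2, by omega⟩
  have h_sum (c : ℕ) : ∑ j ∈ Finset.range (c + 1), ((j + (m + 2) - 2).choose j : ℚ) =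
      ((c + (m + 2) - 1).choose c : ℚ) := by
    rw [show c + (m + 2) - 1 = c + m + 1 by omega, ← sum_range_choose_add_self]
    push_cast
    exact Finset.sum_congr rfl fun j _ => by rw [show j + (m + 2) - 2 = j + m by omega]
  have hr : (0 : ℚ) < r := by exact_mod_cast hr1
  have hrn : (r : ℚ) ≤ m + 1 := by exact_mod_cast hr2
  have h_left : (a : ℚ) + r ≠ 0 := by positivity
  have h_right : (b : ℚ) + (m + 2 : ℕ) - r ≠ 0 := by
    have hb : (0 : ℚ) ≤ b := b.cast_nonneg
    push_cast
    linarith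
  rw [← Finset.mul_sum, ← Finset.sum_mul, ← Finset.mul_sum, h_sum, h_sum]
  field_simp
  ring
end

section
/- For all integers a, b ≥ 0 and every integer j with 0 ≤ j ≤ b, the pair (F₁, F₂) given by F₁ = Σ_{k=0}^{min(a,b−j)} (−1)^{b−j−k} z₂^k w₂^{k+j} z₁^{a−k} w₁^{b−j−k} / (k!·(k+j)!·(a−k)!·(b−j−k)!) and F₂ = Σ_{k=0}^{min(a,b−j−1)} (−1)^{b−j−k−1} z₂^k w₂^{k+j+1} z₁^{a−k} w₁^{b−j−k−1} / (k!·(k+j+1)!·(a−k)!·(b−j−k−1)!) satisfies the Hermitean monogenicity system ∂_{z₁}F₂ − ∂_{z₂}F₁ = 0 and ∂_{w₁}F₁ + ∂_{w₂}F₂ = 0. -/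
open MvPolynomial

noncomputable section

/-- The polynomial ring `ℂ[z₁, z₂, w₁, w₂]`, with `X 0 = z₁`, `X 1 = z₂`,
`X 2 = w₁`, `X 3 = w₂` (where `w₁, w₂` play the role of `z̄₁, z̄₂`). -/
abbrev CPoly : Type := MvPolynomial (Fin 4) ℂ

def z1 : CPoly := X 0
def z2 : CPoly := X 1
def w1 : CPoly := X 2
def w2 : CPoly := X 3

/-- The pair `(F₁, F₂)` of formula (10) of the paper (initial data `A_{a,b-j}`):
`F₁ = Σ_{k=0}^{min(a,b−j)} (−1)^{b−j−k} z₂^k w₂^{k+j} z₁^{a−k} w₁^{b−j−k} /(k!(k+j)!(a−k)!(b−j−k)!)`,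
`F₂ = Σ_{k=0}^{min(a,b−j−1)} (−1)^{b−j−k−1} z₂^k w₂^{k+j+1} z₁^{a−k} w₁^{b−j−k−1} /(k!(k+j+1)!(a−k)!(b−j−k−1)!)`,
empty sums being `0`.  (Note `Finset.range (min (a+1) (b-j+1))` is `{0,…,min a (b−j)}`
and `Finset.range (min (a+1) (b-j))` is `{0,…,min a (b−j−1)}`, empty when `j = b`.) -/
def PA (a b j : ℕ) : CPoly × CPoly :=
  (∑ k ∈ Finset.range (min (a + 1) (b - j + 1)),
      C ((-1 : ℂ) ^ (b - j - k) /
          ((k.factorial : ℂ) * ((k + j).factorial : ℂ) * ((a - k).factorial : ℂ) *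
            ((b - j - k).factorial : ℂ)))
        * z2 ^ k * w2 ^ (k + j) * z1 ^ (a - k) * w1 ^ (b - j - k),
   ∑ k ∈ Finset.range (min (a + 1) (b - j)),
      C ((-1 : ℂ) ^ (b - j - k - 1) /
          ((k.factorial : ℂ) * ((k + j + 1).factorial : ℂ) * ((a - k).factorial : ℂ) *
            ((b - j - k - 1).factorial : ℂ)))
        * z2 ^ k * w2 ^ (k + j + 1) * z1 ^ (a - k) * w1 ^ (b - j - k - 1))

/-- The pair `(F₁, F₂)` of formula (11) of the paper (initial data `B_{a-i,b}`):
`F₁ = Σ_{k=0}^{min(a−i−1,b)} (−1)^{b−k} z₂^{k+i+1} w₂^k z₁^{a−i−k−1} w₁^{b−k} /((k+i+1)!k!(a−i−k−1)!(b−k)!)`,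
`F₂ = Σ_{k=0}^{min(a−i,b)} (−1)^{b−k} z₂^{k+i} w₂^k z₁^{a−i−k} w₁^{b−k} /((k+i)!k!(a−i−k)!(b−k)!)`,
empty sums being `0`.  (Note `Finset.range (min (a-i) (b+1))` is `{0,…,min (a−i−1) b}`,
empty when `i = a`, and `Finset.range (min (a-i+1) (b+1))` is `{0,…,min (a−i) b}`.) -/
def PB (a b i : ℕ) : CPoly × CPoly :=
  (∑ k ∈ Finset.range (min (a - i) (b + 1)),
      C ((-1 : ℂ) ^ (b - k) /
          (((k + i + 1).factorial : ℂ) * (k.factorial : ℂ) * ((a - i - k - 1).factorial : ℂ) *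
            ((b - k).factorial : ℂ)))
        * z2 ^ (k + i + 1) * w2 ^ k * z1 ^ (a - i - k - 1) * w1 ^ (b - k),
   ∑ k ∈ Finset.range (min (a - i + 1) (b + 1)),
      C ((-1 : ℂ) ^ (b - k) /
          (((k + i).factorial : ℂ) * (k.factorial : ℂ) * ((a - i - k).factorial : ℂ) *
            ((b - k).factorial : ℂ)))
        * z2 ^ (k + i) * w2 ^ k * z1 ^ (a - i - k) * w1 ^ (b - k))

/-- The basis pair `P_{a,b,μ}`: for `a+1−b ≤ μ ≤ a+1` it is given by the formula (10)
with `j = μ − a − 1 + b`; for `−b ≤ μ ≤ a−b` by the formula (11) with `i = a − b − μ`;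
and it is `(0,0)` for `μ` outside `[−b, a+1]`. -/
def Ppair (a b : ℕ) (μ : ℤ) : CPoly × CPoly :=
  if (a : ℤ) + 1 - b ≤ μ ∧ μ ≤ (a : ℤ) + 1 then PA a b (μ - a - 1 + b).toNat
  else if -(b : ℤ) ≤ μ ∧ μ ≤ (a : ℤ) - b then PB a b ((a : ℤ) - b - μ).toNat
  else 0

/-- The scaled divided-power monomial `c · z₂^k w₂^l z₁^m w₁^n / (k! l! m! n!)`. -/
def dividedMonomial (c : ℂ) (k l m n : ℕ) : CPoly :=
  C (c / ((k.factorial : ℂ) * (l.factorial : ℂ) * (m.factorial : ℂ) * (n.factorial : ℂ)))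
    * z2 ^ k * w2 ^ l * z1 ^ m * w1 ^ n

theorem dividedMonomial_neg (c : ℂ) (k l m n : ℕ) :
    dividedMonomial (-c) k l m n = -dividedMonomial c k l m n := by
  simp [dividedMonomial, neg_div]

theorem pderiv_z1_dividedMonomial_zero (c : ℂ) (k l n : ℕ) :
    pderiv (0 : Fin 4) (dividedMonomial c k l 0 n) = 0 := by
  simp [dividedMonomial, z2, w1, w2, pderiv_X]

theorem pderiv_z2_dividedMonomial_zero (c : ℂ) (l m n : ℕ) :
    pderiv (1 : Fin 4) (dividedMonomial c 0 l m n) = 0 := by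
  simp [dividedMonomial, z1, w1, w2, pderiv_X]

theorem pderiv_w1_dividedMonomial_zero (c : ℂ) (k l m : ℕ) :
    pderiv (2 : Fin 4) (dividedMonomial c k l m 0) = 0 := by
  simp [dividedMonomial, z1, z2, w2, pderiv_X]

/-- Differentiating `x^(n+1) / (n+1)!` cancels the leading factor of the factorial. -/
theorem C_div_factorial_succ (c d : ℂ) (n : ℕ) :
    (C (c / (d * ((n + 1).factorial : ℂ))) * ((n : CPoly) + 1) : CPoly) =
      C (c / (d * (n.factorial : ℂ))) := by
  have h : ((n : CPoly) + 1) = C ((n : ℂ) + 1) := by simp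
  have hn : (n : ℂ) + 1 ≠ 0 := Nat.cast_add_one_ne_zero n
  rw [h, ← C_mul, Nat.factorial_succ]
  congr 1
  push_cast
  rw [mul_left_comm, div_mul_eq_mul_div, mul_comm c, mul_div_mul_left _ _ hn]

theorem pderiv_z1_dividedMonomial_succ (c : ℂ) (k l m n : ℕ) :
    pderiv (0 : Fin 4) (dividedMonomial c k l (m + 1) n) = dividedMonomial c k l m n := by
  have h := C_div_factorial_succ c
    ((k.factorial : ℂ) * (l.factorial : ℂ) * (n.factorial : ℂ)) m
  rw [mul_right_comm _ (n.factorial : ℂ), mul_right_comm _ (n.factorial : ℂ)] at h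
  simp only [dividedMonomial]
  rw [← h]
  simp [z1, z2, w1, w2, pderiv_X]
  ring

theorem pderiv_z2_dividedMonomial_succ (c : ℂ) (k l m n : ℕ) :
    pderiv (1 : Fin 4) (dividedMonomial c (k + 1) l m n) = dividedMonomial c k l m n := by
  have h := C_div_factorial_succ c
    ((l.factorial : ℂ) * (m.factorial : ℂ) * (n.factorial : ℂ)) k
  simp only [mul_comm _ (Nat.cast (Nat.factorial (k + 1)) : ℂ),
    mul_comm _ (Nat.cast (Nat.factorial k) : ℂ), ← mul_assoc] at h
  simp only [dividedMonomial]
  rw [← h]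
  simp [z1, z2, w1, w2, pderiv_X]
  ring

theorem pderiv_w1_dividedMonomial_succ (c : ℂ) (k l m n : ℕ) :
    pderiv (2 : Fin 4) (dividedMonomial c k l m (n + 1)) = dividedMonomial c k l m n := by
  have h := C_div_factorial_succ c
    ((k.factorial : ℂ) * (l.factorial : ℂ) * (m.factorial : ℂ)) n
  simp only [dividedMonomial]
  rw [← h]
  simp [z1, z2, w1, w2, pderiv_X]
  ring

theorem pderiv_w2_dividedMonomial_succ (c : ℂ) (k l m n : ℕ) :
    pderiv (3 : Fin 4) (dividedMonomial c k (l + 1) m n) = dividedMonomial c k l m n := by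
  have h := C_div_factorial_succ c
    ((k.factorial : ℂ) * (m.factorial : ℂ) * (n.factorial : ℂ)) l
  rw [mul_right_comm _ (n.factorial : ℂ) ((l + 1).factorial : ℂ),
    mul_right_comm _ (n.factorial : ℂ) (l.factorial : ℂ),
    mul_right_comm _ (m.factorial : ℂ) ((l + 1).factorial : ℂ),
    mul_right_comm _ (m.factorial : ℂ) (l.factorial : ℂ)] at h
  simp only [dividedMonomial]
  rw [← h]
  simp [z1, z2, w1, w2, pderiv_X]
  ring

theorem PA_fst (a b j : ℕ) :
    (PA a b j).1 = ∑ k ∈ Finset.range (min (a + 1) (b - j + 1)),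
      dividedMonomial ((-1) ^ (b - j - k)) k (k + j) (a - k) (b - j - k) := rfl

theorem PA_snd (a b j : ℕ) :
    (PA a b j).2 = ∑ k ∈ Finset.range (min (a + 1) (b - j)),
      dividedMonomial ((-1) ^ (b - j - k - 1)) k (k + j + 1) (a - k) (b - j - k - 1) := rfl

theorem pderiv_z1_PA_snd (a b j : ℕ) :
    pderiv (0 : Fin 4) (PA a b j).2 = ∑ k ∈ Finset.range (min a (b - j)),
      dividedMonomial ((-1) ^ (b - j - k - 1)) k (k + j + 1) (a - k - 1) (b - j - k - 1) := by
  rw [PA_snd, map_sum]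
  symm
  apply Finset.sum_subset_zero_on_sdiff
  · exact Finset.range_mono (by omega)
  · intro k hk
    have hak : a - k = 0 := by grind
    rw [hak, pderiv_z1_dividedMonomial_zero]
  · intro k hk
    obtain ⟨m, hm⟩ : ∃ m, a - k = m + 1 := ⟨a - k - 1, by grind⟩
    rw [hm, pderiv_z1_dividedMonomial_succ, Nat.add_sub_cancel]

theorem pderiv_z2_PA_fst (a b j : ℕ) :
    pderiv (1 : Fin 4) (PA a b j).1 = ∑ k ∈ Finset.range (min a (b - j)),
      dividedMonomial ((-1) ^ (b - j - k - 1)) k (k + j + 1) (a - k - 1) (b - j - k - 1) := by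
  rw [PA_fst, map_sum, Nat.add_min_add_right, Finset.sum_range_succ',
    pderiv_z2_dividedMonomial_zero, add_zero]
  refine Finset.sum_congr rfl fun k _ => ?_
  rw [pderiv_z2_dividedMonomial_succ, Nat.add_right_comm k 1 j, Nat.sub_sub a, Nat.sub_sub (b - j)]

theorem pderiv_w1_PA_fst (a b j : ℕ) :
    pderiv (2 : Fin 4) (PA a b j).1 = -∑ k ∈ Finset.range (min (a + 1) (b - j)),
      dividedMonomial ((-1) ^ (b - j - k - 1)) k (k + j) (a - k) (b - j - k - 1) := by
  rw [PA_fst, map_sum, ← Finset.sum_neg_distrib]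
  symm
  apply Finset.sum_subset_zero_on_sdiff
  · exact Finset.range_mono (by omega)
  · intro k hk
    have hbk : b - j - k = 0 := by grind
    rw [hbk, pderiv_w1_dividedMonomial_zero]
  · intro k hk
    obtain ⟨m, hm⟩ : ∃ m, b - j - k = m + 1 := ⟨b - j - k - 1, by grind⟩
    rw [hm, pderiv_w1_dividedMonomial_succ, Nat.add_sub_cancel, pow_succ, mul_neg_one,
      dividedMonomial_neg]

theorem pderiv_w2_PA_snd (a b j : ℕ) :
    pderiv (3 : Fin 4) (PA a b j).2 = ∑ k ∈ Finset.range (min (a + 1) (b - j)),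
      dividedMonomial ((-1) ^ (b - j - k - 1)) k (k + j) (a - k) (b - j - k - 1) := by
  simp only [PA_snd, map_sum, pderiv_w2_dividedMonomial_succ]

/-- for `0 ≤ j ≤ b`, the pair (10) satisfies the Hermitean monogenicity
system `∂_{z₁}F₂ − ∂_{z₂}F₁ = 0` and `∂_{w₁}F₁ + ∂_{w₂}F₂ = 0`. -/
theorem PA_hermitean_monogenic (a b j : ℕ) (hj : j ≤ b) :
    pderiv (0 : Fin 4) (PA a b j).2 - pderiv (1 : Fin 4) (PA a b j).1 = 0 ∧
    pderiv (2 : Fin 4) (PA a b j).1 + pderiv (3 : Fin 4) (PA a b j).2 = 0 := by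
  rw [pderiv_z1_PA_snd, pderiv_z2_PA_fst, pderiv_w1_PA_fst, pderiv_w2_PA_snd]
  exact ⟨sub_self _, neg_add_cancel _⟩

end
end

section
/- (Appell property, part (ii) of Theorem 5.) For all integers a ≥ 1, b ≥ 0 and every integer μ, applying ∂_{z₂} componentwise yields ∂_{z₂} P_{a,b,μ} = P_{a−1,b,μ}. -/
open MvPolynomial

noncomputable section

/-- The monomial `(−1)^s z₂^p w₂^q z₁^r w₁^s / (p! q! r! s!)`. -/
def signedMonomial (p q r s : ℕ) : CPoly :=
  C ((-1 : ℂ) ^ s / ((p.factorial : ℂ) * (q.factorial : ℂ) * (r.factorial : ℂ) * (s.factorial : ℂ)))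
    * z2 ^ p * w2 ^ q * z1 ^ r * w1 ^ s

/-- The extension of `signedMonomial` by zero to integer exponents. -/
def signedMonomialInt (p q r s : ℤ) : CPoly :=
  if 0 ≤ p ∧ 0 ≤ q ∧ 0 ≤ r ∧ 0 ≤ s then
    signedMonomial p.toNat q.toNat r.toNat s.toNat
  else 0

/-- The sum of the monomials `z₂^p w₂^(p+j) z₁^(a−p) w₁^(b−j−p)`, normalized as in
`signedMonomial`, over all `p` for which the exponents are nonnegative. -/
def signedMonomialSum (a b : ℕ) (j : ℤ) : CPoly :=
  ∑ p ∈ Finset.range (a + 1), signedMonomialInt p (p + j) (a - p) (b - j - p)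

lemma signedMonomialInt_natCast (p q r s : ℕ) :
    signedMonomialInt p q r s = signedMonomial p q r s := by
  simp [signedMonomialInt]

lemma signedMonomialInt_eq_zero {p q r s : ℤ} (h : p < 0 ∨ q < 0 ∨ r < 0 ∨ s < 0) :
    signedMonomialInt p q r s = 0 :=
  if_neg (by omega)

lemma pderiv_signedMonomial_zero (q r s : ℕ) :
    pderiv (1 : Fin 4) (signedMonomial 0 q r s) = 0 := by
  simp [signedMonomial, z1, w1, w2, pderiv_X, Derivation.leibniz_pow]

lemma pderiv_signedMonomial_succ (p q r s : ℕ) :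
    pderiv (1 : Fin 4) (signedMonomial (p + 1) q r s) = signedMonomial p q r s := by
  have hcoeff : (-1 : ℂ) ^ s / (((p + 1).factorial : ℂ) * (q.factorial : ℂ) * (r.factorial : ℂ) *
      (s.factorial : ℂ)) * ((p + 1 : ℕ) : ℂ) =
      (-1 : ℂ) ^ s / ((p.factorial : ℂ) * (q.factorial : ℂ) * (r.factorial : ℂ) *
        (s.factorial : ℂ)) := by
    have hp : ((p + 1 : ℕ) : ℂ) ≠ 0 := Nat.cast_ne_zero.mpr p.succ_ne_zero
    have hf (n : ℕ) : (n.factorial : ℂ) ≠ 0 := Nat.cast_ne_zero.mpr n.factorial_ne_zero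
    have := hf p
    have := hf q
    have := hf r
    have := hf s
    rw [Nat.factorial_succ, Nat.cast_mul]
    field_simp
  unfold signedMonomial
  rw [← hcoeff, C_mul, map_natCast C]
  simp [z1, z2, w1, w2, pderiv_X, Derivation.leibniz_pow]
  ring

lemma pderiv_signedMonomialInt (p q r s : ℤ) :
    pderiv (1 : Fin 4) (signedMonomialInt p q r s) = signedMonomialInt (p - 1) q r s := by
  by_cases h : 0 ≤ p ∧ 0 ≤ q ∧ 0 ≤ r ∧ 0 ≤ s
  · obtain ⟨hp, hq, hr, hs⟩ := h
    lift p to ℕ using hp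
    lift q to ℕ using hq
    lift r to ℕ using hr
    lift s to ℕ using hs
    rw [signedMonomialInt_natCast]
    cases p with
    | zero =>
      rw [pderiv_signedMonomial_zero, signedMonomialInt_eq_zero (by omega)]
    | succ p =>
      rw [pderiv_signedMonomial_succ, Nat.cast_succ, add_sub_cancel_right,
        signedMonomialInt_natCast]
  · rw [signedMonomialInt_eq_zero (by omega), signedMonomialInt_eq_zero (by omega), map_zero]

lemma pderiv_signedMonomialSum (a b : ℕ) (j : ℤ) :
    pderiv (1 : Fin 4) (signedMonomialSum (a + 1) b j) = signedMonomialSum a b (j + 1) := by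
  unfold signedMonomialSum
  rw [map_sum, Finset.sum_range_succ', pderiv_signedMonomialInt,
    signedMonomialInt_eq_zero (by omega), add_zero]
  refine Finset.sum_congr rfl fun p _ => ?_
  rw [pderiv_signedMonomialInt]
  congr 1 <;> push_cast <;> ring

lemma signedMonomialSum_natCast (a b j : ℕ) :
    signedMonomialSum a b j = ∑ k ∈ Finset.range (min (a + 1) (b + 1 - j)),
      signedMonomial k (k + j) (a - k) (b - j - k) := by
  unfold signedMonomialSum
  rw [← Finset.sum_subset (Finset.range_mono (min_le_left (a + 1) (b + 1 - j)))]
  · refine Finset.sum_congr rfl fun k hk => ?_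
    rw [Finset.mem_range] at hk
    rw [← signedMonomialInt_natCast]
    congr 1 <;> omega
  · intro k hk hk'
    rw [Finset.mem_range] at hk hk'
    exact signedMonomialInt_eq_zero (by omega)

lemma signedMonomialSum_neg_natCast {a i : ℕ} (b : ℕ) (hi : i ≤ a + 1) :
    signedMonomialSum a b (-i) = ∑ k ∈ Finset.range (min (a + 1 - i) (b + 1)),
      signedMonomial (k + i) k (a - i - k) (b - k) := by
  unfold signedMonomialSum
  rw [show a + 1 = i + (a + 1 - i) by omega, Finset.sum_range_add, Finset.sum_eq_zero, zero_add,
    show i + (a + 1 - i) - i = a + 1 - i by omega,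
    ← Finset.sum_subset (Finset.range_mono (min_le_left (a + 1 - i) (b + 1)))]
  · refine Finset.sum_congr rfl fun k hk => ?_
    rw [Finset.mem_range] at hk
    rw [← signedMonomialInt_natCast]
    congr 1 <;> omega
  · intro k hk hk'
    rw [Finset.mem_range] at hk hk'
    exact signedMonomialInt_eq_zero (by omega)
  · intro k hk
    rw [Finset.mem_range] at hk
    exact signedMonomialInt_eq_zero (by omega)

lemma signedMonomialSum_eq_zero {a b : ℕ} {j : ℤ} (h : (b : ℤ) < j ∨ j < -(a : ℤ)) :
    signedMonomialSum a b j = 0 := by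
  refine Finset.sum_eq_zero fun p hp => ?_
  rw [Finset.mem_range] at hp
  exact signedMonomialInt_eq_zero (by omega)

lemma PA_eq_signedMonomialSum {b j : ℕ} (a : ℕ) (hj : j ≤ b) :
    PA a b j = (signedMonomialSum a b j, signedMonomialSum a b (j + 1)) := by
  rw [← Nat.cast_succ, signedMonomialSum_natCast, signedMonomialSum_natCast,
    Nat.sub_add_comm hj, Nat.add_sub_add_right]
  refine Prod.ext rfl ?_
  dsimp only [PA]
  refine Finset.sum_congr rfl fun k _ => ?_
  rw [show b - (j + 1) - k = b - j - k - 1 by omega]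
  rfl

lemma PB_eq_signedMonomialSum {a i : ℕ} (b : ℕ) (hi : i ≤ a) :
    PB a b i = (signedMonomialSum a b (-(i + 1 : ℕ)), signedMonomialSum a b (-i)) := by
  rw [signedMonomialSum_neg_natCast b (by omega), signedMonomialSum_neg_natCast b (by omega),
    Nat.sub_add_comm hi, Nat.add_sub_add_right]
  refine Prod.ext ?_ rfl
  dsimp only [PB]
  refine Finset.sum_congr rfl fun k _ => ?_
  rw [show a - (i + 1) - k = a - i - k - 1 by omega]
  rfl

lemma Ppair_eq_signedMonomialSum (a b : ℕ) (μ : ℤ) :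
    Ppair a b μ = (signedMonomialSum a b (μ - a - 1 + b), signedMonomialSum a b (μ - a + b)) := by
  unfold Ppair
  split_ifs with hA hB
  · rw [PA_eq_signedMonomialSum a (by omega)]
    congr 2 <;> omega
  · rw [PB_eq_signedMonomialSum b (by omega)]
    congr 2 <;> omega
  · rw [signedMonomialSum_eq_zero (by omega), signedMonomialSum_eq_zero (by omega)]
    rfl

/-- Appell property (ii): for `a ≥ 1`, `b ≥ 0` and every integer `μ`,
`∂_{z₂} P_{a,b,μ} = P_{a−1,b,μ}` componentwise. -/
theorem Ppair_appell_z2 (a b : ℕ) (ha : 1 ≤ a) (μ : ℤ) :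
    (pderiv (1 : Fin 4) (Ppair a b μ).1, pderiv (1 : Fin 4) (Ppair a b μ).2)
      = Ppair (a - 1) b μ := by
  obtain ⟨a, rfl⟩ : ∃ n, a = n + 1 := ⟨a - 1, by omega⟩
  rw [Nat.add_sub_cancel, Ppair_eq_signedMonomialSum, Ppair_eq_signedMonomialSum,
    pderiv_signedMonomialSum, pderiv_signedMonomialSum]
  congr 2 <;> push_cast <;> ring

end
end

section
/- (Appell property, part (iii) of Theorem 5.) For all integers a ≥ 0, b ≥ 1 and every integer μ, applying ∂_{w₁} componentwise yields ∂_{w₁} P_{a,b,μ} = −P_{a,b−1,μ+1}. -/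
open MvPolynomial

noncomputable section

lemma pderiv_C_mul_mul_w1_pow_succ (c : ℂ) (q : CPoly) (hq : pderiv (2 : Fin 4) q = 0) (n : ℕ) :
    pderiv (2 : Fin 4) (C ((-1 : ℂ) ^ (n + 1) / (c * ((n + 1).factorial : ℂ))) * q * w1 ^ (n + 1))
      = -(C ((-1 : ℂ) ^ n / (c * (n.factorial : ℂ))) * q * w1 ^ n) := by
  have hcoeff : (-1 : ℂ) ^ (n + 1) / (c * ((n + 1).factorial : ℂ)) * ((n + 1 : ℕ) : ℂ)
      = -((-1 : ℂ) ^ n / (c * (n.factorial : ℂ))) := by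
    have h1 : ((n + 1 : ℕ) : ℂ) ≠ 0 := Nat.cast_ne_zero.mpr n.succ_ne_zero
    rw [Nat.factorial_succ, Nat.cast_mul, mul_left_comm, div_mul_eq_mul_div,
      mul_comm ((n + 1 : ℕ) : ℂ), mul_div_mul_right _ _ h1, pow_succ, mul_neg_one, neg_div]
  have hcast : ((n + 1 : ℕ) : CPoly) = C ((n + 1 : ℕ) : ℂ) := (map_natCast C _).symm
  rw [← neg_mul, ← neg_mul, ← C_neg, ← hcoeff, C_mul, ← hcast]
  simp only [Derivation.leibniz, Derivation.leibniz_pow, pderiv_C, hq, w1, pderiv_X_self,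
    smul_eq_mul, nsmul_eq_mul, Nat.add_sub_cancel]
  ring

lemma pderiv_sum_w1_pow (N m : ℕ) (c : ℕ → ℂ) (q : ℕ → CPoly)
    (hq : ∀ k, pderiv (2 : Fin 4) (q k) = 0) :
    pderiv (2 : Fin 4) (∑ k ∈ Finset.range (min N (m + 1)),
        C ((-1 : ℂ) ^ (m - k) / (c k * ((m - k).factorial : ℂ))) * q k * w1 ^ (m - k))
      = -∑ k ∈ Finset.range (min N m),
        C ((-1 : ℂ) ^ (m - 1 - k) / (c k * ((m - 1 - k).factorial : ℂ))) * q k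
          * w1 ^ (m - 1 - k) := by
  rw [map_sum, ← Finset.sum_neg_distrib]
  symm
  apply Finset.sum_subset_zero_on_sdiff
  · exact Finset.range_subset_range.mpr (min_le_min_left _ m.le_succ)
  · intro k hk
    simp only [Finset.mem_sdiff, Finset.mem_range] at hk
    obtain rfl : k = m := by omega
    simp [Derivation.leibniz, hq]
  · intro k hk
    rw [Finset.mem_range] at hk
    obtain ⟨n, hn⟩ : ∃ n, m - k = n + 1 := ⟨m - k - 1, by omega⟩
    rw [show m - 1 - k = n by omega, hn, pderiv_C_mul_mul_w1_pow_succ _ _ (hq k)]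

lemma pderiv_monomial_w1_free (p q r : ℕ) :
    pderiv (2 : Fin 4) (z2 ^ p * w2 ^ q * z1 ^ r) = 0 := by
  simp [z1, z2, w2, Derivation.leibniz, Derivation.leibniz_pow, pderiv_X]

lemma PA_appell_w1 (a b j : ℕ) (hj : j < b) :
    (pderiv (2 : Fin 4) (PA a b j).1, pderiv (2 : Fin 4) (PA a b j).2) = -PA a (b - 1) j := by
  obtain ⟨n, rfl⟩ : ∃ n, b = j + n + 1 := ⟨b - j - 1, by omega⟩
  have h1 : j + n + 1 - j = n + 1 := by omega
  have h2 : j + n + 1 - 1 - j = n := by omega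
  have h3 : n + 1 - 1 = n := rfl
  have h4 (k : ℕ) : n + 1 - k - 1 = n - k := by omega
  have h5 (k : ℕ) : n - k - 1 = n - 1 - k := by omega
  ext1
  · have h := pderiv_sum_w1_pow (a + 1) (n + 1)
      (fun k => (k.factorial : ℂ) * ((k + j).factorial : ℂ) * ((a - k).factorial : ℂ))
      (fun k => z2 ^ k * w2 ^ (k + j) * z1 ^ (a - k)) (fun k => pderiv_monomial_w1_free _ _ _)
    simpa only [PA, h1, h2, h3, Prod.fst_neg, mul_assoc] using h
  · have h := pderiv_sum_w1_pow (a + 1) n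
      (fun k => (k.factorial : ℂ) * ((k + j + 1).factorial : ℂ) * ((a - k).factorial : ℂ))
      (fun k => z2 ^ k * w2 ^ (k + j + 1) * z1 ^ (a - k)) (fun k => pderiv_monomial_w1_free _ _ _)
    simpa only [PA, h1, h2, h4, h5, Prod.snd_neg, mul_assoc] using h

lemma PA_self_appell_w1 (a b : ℕ) :
    (pderiv (2 : Fin 4) (PA a b b).1, pderiv (2 : Fin 4) (PA a b b).2) = 0 := by
  ext1 <;> simp [PA, z1, z2, w2, Derivation.leibniz, Derivation.leibniz_pow, pderiv_X]

lemma PB_appell_w1 (a b i : ℕ) (hb : 1 ≤ b) :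
    (pderiv (2 : Fin 4) (PB a b i).1, pderiv (2 : Fin 4) (PB a b i).2) = -PB a (b - 1) i := by
  have h1 : b - 1 + 1 = b := by omega
  ext1
  · have h := pderiv_sum_w1_pow (a - i) b
      (fun k => ((k + i + 1).factorial : ℂ) * (k.factorial : ℂ) * ((a - i - k - 1).factorial : ℂ))
      (fun k => z2 ^ (k + i + 1) * w2 ^ k * z1 ^ (a - i - k - 1))
      (fun k => pderiv_monomial_w1_free _ _ _)
    simpa only [PB, h1, Prod.fst_neg, mul_assoc] using h
  · have h := pderiv_sum_w1_pow (a - i + 1) b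
      (fun k => ((k + i).factorial : ℂ) * (k.factorial : ℂ) * ((a - i - k).factorial : ℂ))
      (fun k => z2 ^ (k + i) * w2 ^ k * z1 ^ (a - i - k))
      (fun k => pderiv_monomial_w1_free _ _ _)
    simpa only [PB, h1, Prod.snd_neg, mul_assoc] using h

/-- Appell property (iii): for `a ≥ 0`, `b ≥ 1` and every integer `μ`,
`∂_{w₁} P_{a,b,μ} = −P_{a,b−1,μ+1}` componentwise. -/
theorem Ppair_appell_w1 (a b : ℕ) (hb : 1 ≤ b) (μ : ℤ) :
    (pderiv (2 : Fin 4) (Ppair a b μ).1, pderiv (2 : Fin 4) (Ppair a b μ).2)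
      = -Ppair a (b - 1) (μ + 1) := by
  unfold Ppair
  have hb' : ((b - 1 : ℕ) : ℤ) = (b : ℤ) - 1 := by omega
  rw [hb', show μ + 1 - a - 1 + ((b : ℤ) - 1) = μ - a - 1 + b by ring,
    show (a : ℤ) - (b - 1) - (μ + 1) = a - b - μ by ring]
  by_cases hA : (a : ℤ) + 1 - b ≤ μ ∧ μ ≤ (a : ℤ) + 1
  · rw [if_pos hA]
    by_cases hμ : μ = a + 1
    · rw [if_neg (by omega), if_neg (by omega), neg_zero,
        show (μ - a - 1 + b).toNat = b by omega, PA_self_appell_w1]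
    · rw [if_pos (by omega), PA_appell_w1 _ _ _ (by omega)]
  · rw [if_neg hA, if_neg (c := (a : ℤ) + 1 - (b - 1) ≤ μ + 1 ∧ μ + 1 ≤ (a : ℤ) + 1) (by omega)]
    by_cases hB : -(b : ℤ) ≤ μ ∧ μ ≤ (a : ℤ) - b
    · rw [if_pos hB, if_pos (by omega), PB_appell_w1 _ _ _ hb]
    · rw [if_neg hB, if_neg (by omega)]
      simp

end
end

section
/- (Appell property, part (iv) of Theorem 5.) For all integers a ≥ 1, b ≥ 0 and every integer μ, applying ∂_{z₁} componentwise yields ∂_{z₁} P_{a,b,μ} = P_{a−1,b,μ−1}. -/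
open MvPolynomial

noncomputable section

theorem pderiv_zero_monomial (c : ℂ) (p q n r : ℕ) :
    pderiv (0 : Fin 4) (C c * z2 ^ p * w2 ^ q * z1 ^ n * w1 ^ r)
      = C (c * n) * z2 ^ p * w2 ^ q * z1 ^ (n - 1) * w1 ^ r := by
  have h1 : pderiv (0 : Fin 4) z1 = 1 := pderiv_X_self _
  have h2 : pderiv (0 : Fin 4) z2 = 0 := pderiv_X_of_ne (by decide)
  have h3 : pderiv (0 : Fin 4) w1 = 0 := pderiv_X_of_ne (by decide)
  have h4 : pderiv (0 : Fin 4) w2 = 0 := pderiv_X_of_ne (by decide)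
  simp only [pderiv_mul, pderiv_pow, pderiv_C, h1, h2, h3, h4, map_mul, map_natCast]
  ring

theorem pderiv_sum_range_min {f g : ℕ → CPoly} {m n : ℕ}
    (hfg : ∀ k ≤ m, pderiv (0 : Fin 4) (f k) = g k)
    (hf : pderiv (0 : Fin 4) (f (m + 1)) = 0) :
    pderiv (0 : Fin 4) (∑ k ∈ Finset.range (min (m + 2) n), f k)
      = ∑ k ∈ Finset.range (min (m + 1) n), g k := by
  have key (N : ℕ) (hN : N ≤ m + 1) :
      pderiv (0 : Fin 4) (∑ k ∈ Finset.range N, f k) = ∑ k ∈ Finset.range N, g k := by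
    rw [map_sum]
    exact Finset.sum_congr rfl fun k hk => hfg k (by have := Finset.mem_range.1 hk; omega)
  rcases le_or_gt n (m + 1) with h | h
  · rw [min_eq_right (by omega), min_eq_right h, key n h]
  · rw [min_eq_left (by omega), min_eq_left h.le, Finset.sum_range_succ, map_add, hf, add_zero,
      key _ le_rfl]

theorem pderiv_zero_monomial_div_factorial (c A B D : ℂ) (p q n r : ℕ) :
    pderiv (0 : Fin 4)
        (C (c / (A * B * ((n + 1).factorial : ℂ) * D)) * z2 ^ p * w2 ^ q * z1 ^ (n + 1) * w1 ^ r)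
      = C (c / (A * B * (n.factorial : ℂ) * D)) * z2 ^ p * w2 ^ q * z1 ^ n * w1 ^ r := by
  rw [pderiv_zero_monomial, Nat.factorial_succ, Nat.add_sub_cancel]
  congr 5
  have := Nat.cast_add_one_ne_zero (R := ℂ) n
  push_cast
  field_simp

theorem pderiv_PA_succ (a b j : ℕ) :
    (pderiv (0 : Fin 4) (PA (a + 1) b j).1, pderiv (0 : Fin 4) (PA (a + 1) b j).2)
      = PA a b j := by
  unfold PA
  refine Prod.ext (pderiv_sum_range_min (fun k hk => ?_) ?_)
    (pderiv_sum_range_min (fun k hk => ?_) ?_)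
  case refine_2 | refine_4 =>
    rw [pderiv_zero_monomial]
    simp
  all_goals rw [show a + 1 - k = (a - k) + 1 by omega, pderiv_zero_monomial_div_factorial]

theorem pderiv_PB_self (a b : ℕ) :
    (pderiv (0 : Fin 4) (PB a b a).1, pderiv (0 : Fin 4) (PB a b a).2) = 0 := by
  have h : min (0 + 1) (b + 1) = 1 := by omega
  unfold PB
  simp only [Nat.sub_self, h, Nat.zero_min, Finset.sum_range_zero, Finset.sum_range_one,
    pderiv_zero_monomial]
  simp

theorem pderiv_PB_succ (a b i : ℕ) (hi : i ≤ a) :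
    (pderiv (0 : Fin 4) (PB (a + 1) b i).1, pderiv (0 : Fin 4) (PB (a + 1) b i).2)
      = PB a b i := by
  obtain ⟨m, rfl⟩ := Nat.exists_eq_add_of_le hi
  have h1 : i + m + 1 - i = m + 1 := by omega
  have h2 : i + m - i = m := by omega
  unfold PB
  simp only [h1, h2]
  refine Prod.ext ?_ (pderiv_sum_range_min (fun k hk => ?_) ?_)
  · cases m with
    | zero =>
      have h : min (0 + 1) (b + 1) = 1 := by omega
      simp only [h, Nat.zero_min, Finset.sum_range_zero, Finset.sum_range_one,
        pderiv_zero_monomial]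
      simp
    | succ m =>
      refine pderiv_sum_range_min (fun k hk => ?_) ?_
      · rw [show m + 1 + 1 - k - 1 = (m + 1 - k - 1) + 1 by omega,
          pderiv_zero_monomial_div_factorial]
      · rw [pderiv_zero_monomial]
        simp
  · rw [show m + 1 - k = (m - k) + 1 by omega, pderiv_zero_monomial_div_factorial]
  · rw [pderiv_zero_monomial]
    simp

/-- Appell property (iv): for `a ≥ 1`, `b ≥ 0` and every integer `μ`,
`∂_{z₁} P_{a,b,μ} = P_{a−1,b,μ−1}` componentwise. -/
theorem Ppair_appell_z1 (a b : ℕ) (ha : 1 ≤ a) (μ : ℤ) :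
    (pderiv (0 : Fin 4) (Ppair a b μ).1, pderiv (0 : Fin 4) (Ppair a b μ).2)
      = Ppair (a - 1) b (μ - 1) := by
  obtain ⟨a, rfl⟩ := Nat.exists_eq_add_of_le' ha
  rw [Nat.add_sub_cancel]
  by_cases hA : (a : ℤ) + 1 - b ≤ μ - 1 ∧ μ - 1 ≤ (a : ℤ) + 1
  · have hj : (μ - ((a + 1 : ℕ) : ℤ) - 1 + b).toNat = (μ - 1 - a - 1 + b).toNat := by
      congr 1; push_cast; ring
    rw [Ppair, Ppair, if_pos hA, if_pos (by push_cast; omega), hj, pderiv_PA_succ]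
  rw [Ppair, Ppair, if_neg hA, if_neg (by push_cast; omega)]
  by_cases hB : -(b : ℤ) ≤ μ - 1 ∧ μ - 1 ≤ (a : ℤ) - b
  · have hi : (((a + 1 : ℕ) : ℤ) - b - μ).toNat = ((a : ℤ) - b - (μ - 1)).toNat := by
      congr 1; push_cast; ring
    rw [if_pos hB, if_pos (by push_cast; omega), hi, pderiv_PB_succ _ _ _ (by omega)]
  rw [if_neg hB]
  by_cases hμ : μ = -b
  · have hi : (((a + 1 : ℕ) : ℤ) - b - μ).toNat = a + 1 := by omega
    rw [if_pos (by push_cast; omega), hi, pderiv_PB_self]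
  · rw [if_neg (by push_cast; omega)]
    simp

end
end

section
/- For all integers a, b ≥ 0 and all integers μ ≠ ν with −b ≤ μ ≤ a+1 and −b ≤ ν ≤ a+1, the pairs P_{a,b,μ} and P_{a,b,ν} are orthogonal with respect to the Fischer inner product: ⟨P_{a,b,μ}, P_{a,b,ν}⟩_F = 0. -/
open MvPolynomial

noncomputable section

/-- The Fischer inner product of two pairs of polynomials in `ℂ[z₁,z₂,w₁,w₂]`:
`⟨(P₁,P₂),(Q₁,Q₂)⟩_F = Σ_m m!·(conj((P₁)_m)·(Q₁)_m + conj((P₂)_m)·(Q₂)_m)`,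
the sum running over all multi-indices `m` (only finitely many terms are nonzero). -/
def fischer (p q : CPoly × CPoly) : ℂ :=
  ∑ᶠ m : Fin 4 →₀ ℕ,
    (((m 0).factorial * (m 1).factorial * (m 2).factorial * (m 3).factorial : ℕ) : ℂ) *
      ((starRingEnd ℂ) (coeff m p.1) * coeff m q.1
        + (starRingEnd ℂ) (coeff m p.2) * coeff m q.2)

lemma coeff_term_ne_zero {c : ℂ} {p q r s : ℕ} {m : Fin 4 →₀ ℕ}
    (h : coeff m (C c * z2 ^ p * w2 ^ q * z1 ^ r * w1 ^ s) ≠ 0) : m 1 = p ∧ m 3 = q := by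
  have hmon : C c * z2 ^ p * w2 ^ q * z1 ^ r * w1 ^ s =
      monomial (Finsupp.single 1 p + Finsupp.single 3 q + Finsupp.single 0 r +
        Finsupp.single 2 s : Fin 4 →₀ ℕ) c := by
    simp [z1, z2, w1, w2, X_pow_eq_monomial, C_mul_monomial, monomial_mul]
  rw [hmon, coeff_monomial] at h
  obtain rfl := (ite_ne_right_iff.mp h).1
  simp

lemma PA_coeff_fst_ne_zero {a b j : ℕ} {m : Fin 4 →₀ ℕ} (h : coeff m (PA a b j).1 ≠ 0) :
    (m 1 : ℤ) - m 3 = -j := by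
  rw [PA, coeff_sum] at h
  obtain ⟨k, -, hk⟩ := Finset.exists_ne_zero_of_sum_ne_zero h
  have := coeff_term_ne_zero hk
  omega

lemma PA_coeff_snd_ne_zero {a b j : ℕ} {m : Fin 4 →₀ ℕ} (h : coeff m (PA a b j).2 ≠ 0) :
    (m 1 : ℤ) - m 3 = -j - 1 := by
  rw [PA, coeff_sum] at h
  obtain ⟨k, -, hk⟩ := Finset.exists_ne_zero_of_sum_ne_zero h
  have := coeff_term_ne_zero hk
  omega

lemma PB_coeff_fst_ne_zero {a b i : ℕ} {m : Fin 4 →₀ ℕ} (h : coeff m (PB a b i).1 ≠ 0) :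
    (m 1 : ℤ) - m 3 = i + 1 := by
  rw [PB, coeff_sum] at h
  obtain ⟨k, -, hk⟩ := Finset.exists_ne_zero_of_sum_ne_zero h
  have := coeff_term_ne_zero hk
  omega

lemma PB_coeff_snd_ne_zero {a b i : ℕ} {m : Fin 4 →₀ ℕ} (h : coeff m (PB a b i).2 ≠ 0) :
    (m 1 : ℤ) - m 3 = i := by
  rw [PB, coeff_sum] at h
  obtain ⟨k, -, hk⟩ := Finset.exists_ne_zero_of_sum_ne_zero h
  have := coeff_term_ne_zero hk
  omega

/-- The first component of `P_{a,b,μ}` is homogeneous of weight `a + 1 - b - μ` when `z₂` has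
weight `1`, `w₂` has weight `-1`, and `z₁`, `w₁` have weight `0`. -/
lemma Ppair_coeff_fst_ne_zero {a b : ℕ} {μ : ℤ} {m : Fin 4 →₀ ℕ}
    (h : coeff m (Ppair a b μ).1 ≠ 0) : (m 1 : ℤ) - m 3 = a + 1 - b - μ := by
  unfold Ppair at h
  split_ifs at h
  · have := PA_coeff_fst_ne_zero h
    omega
  · have := PB_coeff_fst_ne_zero h
    omega
  · simp at h

/-- The second component of `P_{a,b,μ}` is homogeneous of weight `a - b - μ` when `z₂` has
weight `1`, `w₂` has weight `-1`, and `z₁`, `w₁` have weight `0`. -/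
lemma Ppair_coeff_snd_ne_zero {a b : ℕ} {μ : ℤ} {m : Fin 4 →₀ ℕ}
    (h : coeff m (Ppair a b μ).2 ≠ 0) : (m 1 : ℤ) - m 3 = a - b - μ := by
  unfold Ppair at h
  split_ifs at h
  · have := PA_coeff_snd_ne_zero h
    omega
  · have := PB_coeff_snd_ne_zero h
    omega
  · simp at h

/-- for `−b ≤ μ, ν ≤ a+1` with `μ ≠ ν`, the pairs `P_{a,b,μ}` and
`P_{a,b,ν}` are orthogonal with respect to the Fischer inner product. -/
theorem Ppair_fischer_orthogonal (a b : ℕ) (μ ν : ℤ)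
    (hμ1 : -(b : ℤ) ≤ μ) (hμ2 : μ ≤ (a : ℤ) + 1)
    (hν1 : -(b : ℤ) ≤ ν) (hν2 : ν ≤ (a : ℤ) + 1) (hne : μ ≠ ν) :
    fischer (Ppair a b μ) (Ppair a b ν) = 0 := by
  have hfst (m : Fin 4 →₀ ℕ) :
      (starRingEnd ℂ) (coeff m (Ppair a b μ).1) * coeff m (Ppair a b ν).1 = 0 := by
    by_contra h
    obtain ⟨h₁, h₂⟩ := mul_ne_zero_iff.mp h
    have := Ppair_coeff_fst_ne_zero ((map_ne_zero _).mp h₁)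
    have := Ppair_coeff_fst_ne_zero h₂
    omega
  have hsnd (m : Fin 4 →₀ ℕ) :
      (starRingEnd ℂ) (coeff m (Ppair a b μ).2) * coeff m (Ppair a b ν).2 = 0 := by
    by_contra h
    obtain ⟨h₁, h₂⟩ := mul_ne_zero_iff.mp h
    have := Ppair_coeff_snd_ne_zero ((map_ne_zero _).mp h₁)
    have := Ppair_coeff_snd_ne_zero h₂
    omega
  simp only [fischer, hfst, hsnd, add_zero, mul_zero, finsum_zero]

end
end
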